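/- Let p be a prime, q a power of p, and let u ∈ GL(n, 𝔽_q) be a unipotent matrix (u − 1 nilpotent) with u^p = 1, where 𝔽_q is the finite field with q elements. Then there exists a group homomorphism φ : SL(2, 𝔽_q) → GL(n, 𝔽_q) whose image contains u. -/

import Mathlib

section BinaryForms

open MvPolynomial

variable {F : Type*} [Field F]

/-- The algebra endomorphism `X i ↦ ∑ j, A j i • X j`. -/
noncomputable def substAlgHom (A : Matrix (Fin 2) (Fin 2) F) :
    MvPolynomial (Fin 2) F →ₐ[F] MvPolynomial (Fin 2) F :=
  aeval fun i => ∑ j, C (A j i) * X j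

theorem substAlgHom_one : substAlgHom (1 : Matrix (Fin 2) (Fin 2) F) = 1 := by
  apply MvPolynomial.algHom_ext
  intro i
  rw [substAlgHom, aeval_X, AlgHom.one_apply, Fin.sum_univ_two]
  fin_cases i <;> simp [Matrix.one_apply]

theorem substAlgHom_mul (A B : Matrix (Fin 2) (Fin 2) F) :
    substAlgHom (A * B) = substAlgHom A * substAlgHom B := by
  apply MvPolynomial.algHom_ext
  intro i
  rw [AlgHom.mul_apply, substAlgHom, substAlgHom, substAlgHom, aeval_X, aeval_X]
  simp only [Matrix.mul_apply, Fin.sum_univ_two, map_add, map_mul, aeval_X, algHom_C,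
    algebraMap_eq]
  ring

/-- The action of `SL(2)` on polynomials by linear substitution of variables. -/
noncomputable def linSubst : Matrix.SpecialLinearGroup (Fin 2) F →*
    Module.End F (MvPolynomial (Fin 2) F) where
  toFun g := (substAlgHom (g : Matrix (Fin 2) (Fin 2) F)).toLinearMap
  map_one' := by
    rw [Matrix.SpecialLinearGroup.coe_one, substAlgHom_one]; rfl
  map_mul' g h := by
    rw [Matrix.SpecialLinearGroup.coe_mul, substAlgHom_mul]; rfl

theorem linSubst_apply (g : Matrix.SpecialLinearGroup (Fin 2) F) (f : MvPolynomial (Fin 2) F) :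
    linSubst g f =
      aeval (R := F) (fun i => ∑ j, C ((g : Matrix (Fin 2) (Fin 2) F) j i) * X j) f := rfl

theorem linSubst_mem (g : Matrix.SpecialLinearGroup (Fin 2) F) (m : ℕ)
    (f : MvPolynomial (Fin 2) F) (hf : f ∈ homogeneousSubmodule (Fin 2) F m) :
    linSubst g f ∈ homogeneousSubmodule (Fin 2) F m := by
  rw [mem_homogeneousSubmodule] at hf ⊢
  have h := hf.aeval (fun i => ∑ j, C ((g : Matrix (Fin 2) (Fin 2) F) j i) * X j)
    fun i => IsHomogeneous.sum _ _ 1 fun j _ => isHomogeneous_C_mul_X _ _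
  rw [one_mul] at h
  exact h

/-- The representation of `SL(2)` on binary forms of degree `m`. -/
noncomputable def binaryFormRep (m : ℕ) : Matrix.SpecialLinearGroup (Fin 2) F →*
    Module.End F (homogeneousSubmodule (Fin 2) F m) where
  toFun g := (linSubst g).restrict (linSubst_mem g m)
  map_one' := by ext1 x; simp [Subtype.ext_iff]
  map_mul' g h := by ext1 x; simp [Subtype.ext_iff]

/-- The coefficients of a binary form of degree `m`. -/
noncomputable def binaryFormCoeff (m : ℕ) :
    homogeneousSubmodule (Fin 2) F m →ₗ[F] (Fin (m + 1) → F) :=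
  LinearMap.pi fun i => lcoeff F (Finsupp.single 0 (m - i : ℕ) + Finsupp.single 1 (i : ℕ)) ∘ₗ
    Submodule.subtype _

theorem binaryFormCoeff_injective (m : ℕ) :
    Function.Injective (binaryFormCoeff (F := F) m) := by
  rw [← LinearMap.ker_eq_bot, LinearMap.ker_eq_bot']
  rintro ⟨f, hf⟩ h
  ext d
  rw [mem_homogeneousSubmodule] at hf
  by_cases hd : d.degree = m
  · have hd' : d 0 + d 1 = m := by
      simpa [Finsupp.degree_eq_sum] using hd
    have := congrFun h ⟨d 1, by omega⟩
    have e : Finsupp.single 0 (m - d 1) + Finsupp.single 1 (d 1) = d := by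
      ext i; fin_cases i <;> simp; omega
    rw [← e]; exact this
  · simpa using hf.coeff_eq_zero hd

instance (m : ℕ) : Module.Finite F (homogeneousSubmodule (Fin 2) F m) :=
  Module.Finite.of_injective _ (binaryFormCoeff_injective m)

theorem finrank_binaryForm_le (m : ℕ) :
    Module.finrank F (homogeneousSubmodule (Fin 2) F m) ≤ m + 1 := by
  simpa using LinearMap.finrank_le_finrank_of_injective (binaryFormCoeff_injective (F := F) m)

/-- The upper unitriangular matrix with off-diagonal entry `1`. -/
def stdUnipotent (F : Type*) [Field F] : Matrix.SpecialLinearGroup (Fin 2) F :=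
  ⟨!![1, 1; 0, 1], by simp⟩

theorem stdUnipotent_pow (k : ℕ) :
    (stdUnipotent F ^ k : Matrix.SpecialLinearGroup (Fin 2) F) = !![1, (k : F); 0, 1] := by
  induction k with
  | zero => simp [Matrix.one_fin_two]
  | succ k ih =>
    rw [pow_succ, Matrix.SpecialLinearGroup.coe_mul, ih]
    simp [stdUnipotent, add_comm]

theorem stdUnipotent_pow_char (p : ℕ) [CharP F p] : stdUnipotent F ^ p = 1 := by
  ext1 i j
  rw [stdUnipotent_pow]
  simp [Matrix.one_fin_two]

theorem sub_one_pow_char_eq_zero {V : Type*} [AddCommGroup V] [Module F V] (p : ℕ) [Fact p.Prime]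
    [CharP F p] (a : Module.End F V) (h : a ^ p = 1) : (a - 1) ^ p = 0 := by
  have := congrArg (Polynomial.aeval a) (sub_pow_char (p := p) (Polynomial.X : Polynomial F) 1)
  simpa [h] using this

theorem eval_linSubst (f : MvPolynomial (Fin 2) F) (t : F) :
    eval ![1, t] (linSubst (stdUnipotent F) f) = eval ![1, t + 1] f := by
  rw [linSubst_apply, ← coe_aeval_eq_eval, ← coe_aeval_eq_eval]
  change ((aeval _).comp (aeval _)) f = aeval _ f
  congr 1
  ext i
  fin_cases i <;> simp [stdUnipotent, add_comm]

theorem eval_linSubst_sub_one_pow_eq_fwdDiff (f : MvPolynomial (Fin 2) F) (k : ℕ) :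
    (fun t => eval ![1, t] (((linSubst (stdUnipotent F) - 1) ^ k) f)) =
      (fwdDiff 1)^[k] (fun t => eval ![1, t] f) := by
  induction k with
  | zero => simp
  | succ k ih =>
    rw [pow_succ', Function.iterate_succ_apply', ← ih]
    ext t
    simp [fwdDiff, eval_linSubst]

theorem eval_linSubst_sub_one_pow (m : ℕ) :
    eval ![1, 0] (((linSubst (stdUnipotent F) - 1) ^ m) (X 1 ^ m)) = (m.factorial : F) := by
  have := congrFun (eval_linSubst_sub_one_pow_eq_fwdDiff (F := F) (X 1 ^ m) m) 0
  rw [this]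
  simpa using congrFun (fwdDiff_iter_eq_factorial (R := F) (n := m)) 0

theorem coe_binaryFormRep_pow (m k : ℕ) (g : Matrix.SpecialLinearGroup (Fin 2) F)
    (f : homogeneousSubmodule (Fin 2) F m) :
    (((binaryFormRep m g - 1) ^ k) f : MvPolynomial (Fin 2) F) =
      ((linSubst g - 1) ^ k) (f : MvPolynomial (Fin 2) F) := by
  induction k with
  | zero => simp
  | succ k ih =>
    rw [pow_succ', pow_succ', Module.End.mul_apply, Module.End.mul_apply, ← ih]
    rfl

end BinaryForms

section JordanBlocks

open Polynomial

variable {F : Type*} [Field F]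

theorem nonempty_aeval_equiv_quotient {V : Type*} [AddCommGroup V] [Module F V]
    [Module.Finite F V] {N : Module.End F V} (hN : IsNilpotent N) {m : ℕ}
    (hm : Module.finrank F V ≤ m + 1) {w : V} (hw : (N ^ m) w ≠ 0) :
    Nonempty (Module.AEval' N ≃ₗ[F[X]] F[X] ⧸ (F[X] ∙ (X ^ (m + 1) : F[X]))) := by
  have hN0 : N ^ (m + 1) = 0 := by
    obtain ⟨r, hr⟩ := hN
    have h := (LinearMap.charpoly_eq_X_pow_iff N).mpr fun v => ⟨r, by rw [hr]; rfl⟩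
    have h2 := LinearMap.aeval_self_charpoly N
    rw [h, aeval_X_pow] at h2
    exact pow_eq_zero_of_le hm h2
  let f : F[X] →ₗ[F[X]] Module.AEval' N :=
    LinearMap.toSpanSingleton F[X] (Module.AEval' N) (Module.AEval'.of N w)
  have hfX (k : ℕ) : f (X ^ k) = Module.AEval'.of N ((N ^ k) w) :=
    Module.AEval'.X_pow_smul_of N w k
  have hker : LinearMap.ker f = F[X] ∙ (X ^ (m + 1) : F[X]) := by
    obtain ⟨g, hg⟩ := (IsPrincipalIdealRing.principal (LinearMap.ker f)).principal
    have h1 : (X ^ (m + 1) : F[X]) ∈ LinearMap.ker f := by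
      rw [LinearMap.mem_ker, hfX, hN0]; simp
    have h2 := h1
    rw [hg] at h2
    obtain ⟨j, hj, hgj⟩ := (dvd_prime_pow prime_X _).mp (Ideal.mem_span_singleton.mp h2)
    have h3 : (X ^ j : F[X]) ∈ LinearMap.ker f := by
      rw [hg]; exact Ideal.mem_span_singleton.mpr hgj.dvd
    have h4 : j = m + 1 := by
      by_contra hne
      rw [LinearMap.mem_ker, hfX, LinearEquiv.map_eq_zero_iff] at h3
      apply hw
      rw [← Nat.sub_add_cancel (show j ≤ m by omega), pow_add, Module.End.mul_apply, h3, map_zero]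
    rw [hg, ← h4]
    exact Ideal.span_singleton_eq_span_singleton.mpr hgj
  have hsurj : LinearMap.range f = ⊤ := by
    have e := (f.quotKerEquivRange.restrictScalars F).finrank_eq
    rw [hker] at e
    have e2 : Module.finrank F (F[X] ⧸ (F[X] ∙ (X ^ (m + 1) : F[X]))) = m + 1 :=
      (finrank_quotient_span_eq_natDegree (f := (X ^ (m + 1) : F[X]))).trans (natDegree_X_pow _)
    have e3 : Module.finrank F (Module.AEval' N) ≤ m + 1 :=
      (Module.AEval'.of N).finrank_eq ▸ hm
    have : Module.Finite F (Module.AEval' N) := Module.Finite.equiv (Module.AEval'.of N)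
    have e4 : (LinearMap.range f).restrictScalars F = ⊤ := by
      apply Submodule.eq_top_of_finrank_eq
      refine le_antisymm (Submodule.finrank_le _) ?_
      refine e3.trans (e2.symm.trans e).le
    simpa using e4
  exact ⟨((Submodule.quotEquivOfEq _ _ hker.symm).trans
    (f.quotKerEquivOfSurjective (LinearMap.range_eq_top.mp hsurj))).symm⟩

/-- The endomorphism `1 + N` is the image of the standard unipotent element under some
representation of `SL(2, F)`. -/
def ExtendsToSL2 {V : Type*} [AddCommGroup V] [Module F V] (N : Module.End F V) : Prop :=
  ∃ ρ : Matrix.SpecialLinearGroup (Fin 2) F →* Module.End F V, ρ (stdUnipotent F) = 1 + N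

namespace ExtendsToSL2

theorem congr {V W : Type*} [AddCommGroup V] [Module F V] [AddCommGroup W] [Module F W]
    {N : Module.End F V} {M : Module.End F W} (h : ExtendsToSL2 N) (e : V ≃ₗ[F] W)
    (he : ∀ v, e (N v) = M (e v)) : ExtendsToSL2 M := by
  obtain ⟨ρ, hρ⟩ := h
  refine ⟨(e.conjRingEquiv : Module.End F V →* Module.End F W).comp ρ, ?_⟩
  ext w
  simp [hρ, he]

theorem directSum {ι : Type*} {V : ι → Type*} [∀ i, AddCommGroup (V i)] [∀ i, Module F (V i)]
    {N : ∀ i, Module.End F (V i)} (h : ∀ i, ExtendsToSL2 (N i)) :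
    ExtendsToSL2 (DirectSum.lmap N) := by
  choose ρ hρ using h
  refine ⟨⟨⟨fun g => DirectSum.lmap fun i => ρ i g, ?_⟩, ?_⟩, ?_⟩
  · simp only [map_one]
    exact DirectSum.lmap_id
  · intro g h
    simp only [map_mul]
    exact DirectSum.lmap_comp _ _
  · ext1 x
    refine DFinsupp.ext fun i => ?_
    change ρ i (stdUnipotent F) (x i) = x i + N i (x i)
    simp [hρ]

end ExtendsToSL2

theorem extendsToSL2_X_smul_quotient (p : ℕ) [Fact p.Prime] [CharP F p] {k : ℕ} (hk : k ≤ p) :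
    ExtendsToSL2 (Module.toModuleEnd F (S := F[X]) (F[X] ⧸ (F[X] ∙ (X ^ k : F[X]))) X) := by
  cases k with
  | zero =>
    have : Subsingleton (F[X] ⧸ (F[X] ∙ (X ^ 0 : F[X]))) := by
      rw [Submodule.Quotient.subsingleton_iff, pow_zero]
      exact Ideal.span_singleton_one
    exact ⟨1, Subsingleton.elim _ _⟩
  | succ m =>
    let N := binaryFormRep m (stdUnipotent F) - 1
    have hN : IsNilpotent N := ⟨p, sub_one_pow_char_eq_zero p _ <| by
      rw [← map_pow, stdUnipotent_pow_char, map_one]⟩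
    let w : MvPolynomial.homogeneousSubmodule (Fin 2) F m :=
      ⟨MvPolynomial.X 1 ^ m, MvPolynomial.isHomogeneous_X_pow 1 m⟩
    have hw : (N ^ m) w ≠ 0 := by
      intro h
      have h1 := eval_linSubst_sub_one_pow (F := F) m
      rw [← coe_binaryFormRep_pow m m (stdUnipotent F) w, h, ZeroMemClass.coe_zero, map_zero,
        eq_comm, CharP.cast_eq_zero_iff F p, (Fact.out : p.Prime).dvd_factorial] at h1
      omega
    obtain ⟨e⟩ := nonempty_aeval_equiv_quotient hN (finrank_binaryForm_le m) hw
    have hρ : ExtendsToSL2 N := ⟨binaryFormRep m, 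
      LinearMap.ext fun v => (add_sub_cancel v (binaryFormRep m (stdUnipotent F) v)).symm⟩
    refine hρ.congr ((Module.AEval'.of N).trans (e.restrictScalars F)) fun v => ?_
    have : e (Module.AEval'.of N (N v)) = (X : F[X]) • e (Module.AEval'.of N v) := by
      rw [← map_smul, Module.AEval'.X_smul_of]
    exact this

theorem extendsToSL2_of_pow_char_eq_zero (p : ℕ) [Fact p.Prime] [CharP F p]
    {V : Type*} [AddCommGroup V] [Module F V] [Module.Finite F V] (N : Module.End F V)
    (hN : N ^ p = 0) : ExtendsToSL2 N := by
  have hX : ∀ v : Module.AEval' N, (X ^ p : F[X]) • v = 0 := fun v => by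
    obtain ⟨v, rfl⟩ := (Module.AEval'.of N).surjective v
    rw [Module.AEval'.X_pow_smul_of, hN]; simp
  obtain ⟨d, k, ⟨e⟩⟩ := Module.torsion_by_prime_power_decomposition (R := F[X])
    (M := Module.AEval' N) (p := X) prime_X.irreducible
    ((Submodule.isTorsion'_powers_iff _).mpr fun v => ⟨p, hX v⟩)
  have hk (i : Fin d) : k i ≤ p := by
    have h0 : (X ^ p : F[X]) • DirectSum.of
        (fun i => F[X] ⧸ (F[X] ∙ (X ^ (k i) : F[X]))) i (Submodule.Quotient.mk 1) = 0 := by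
      rw [← e.apply_symm_apply (DirectSum.of _ _ _), ← map_smul, hX, map_zero]
    have h1 := congrArg (fun x => x i) h0
    have h2 : (Submodule.Quotient.mk ((X ^ p : F[X]) • 1) :
        F[X] ⧸ (F[X] ∙ (X ^ (k i) : F[X]))) = 0 := by
      rw [DirectSum.smul_apply, DirectSum.of_eq_same, DirectSum.zero_apply] at h1
      exact h1
    rw [Submodule.Quotient.mk_eq_zero, smul_eq_mul, mul_one] at h2
    exact (pow_dvd_pow_iff X_ne_zero not_isUnit_X).mp (Ideal.mem_span_singleton.mp h2)
  refine (ExtendsToSL2.directSum fun i => extendsToSL2_X_smul_quotient p (hk i)).congr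
    (((Module.AEval'.of N).trans (e.restrictScalars F)).symm) fun v => ?_
  rw [LinearEquiv.symm_apply_eq]
  obtain ⟨v, rfl⟩ := ((Module.AEval'.of N).trans (e.restrictScalars F)).surjective v
  rw [LinearEquiv.symm_apply_apply]
  have : (X : F[X]) • e (Module.AEval'.of N v) = e (Module.AEval'.of N (N v)) := by
    rw [← map_smul, Module.AEval'.X_smul_of]
  exact this

end JordanBlocks

/-- **Theorem (finite-field case) for `G = GL_n`.**  Let `p` be a prime, `q` a power of `p`,
and let `u ∈ GL(n, 𝔽_q)` be a unipotent matrix (`u - 1` nilpotent) with `u ^ p = 1`, where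
`𝔽_q` is the finite field with `q` elements.  Then there exists a group homomorphism
`φ : SL(2, 𝔽_q) → GL(n, 𝔽_q)` whose image contains `u`. -/
theorem testerman_GLn_finite_field
    (p : ℕ) (hp : p.Prime) (q : ℕ) (hq : ∃ m : ℕ, 0 < m ∧ q = p ^ m)
    (F : Type*) [Field F] [Fintype F] (hcard : Fintype.card F = q)
    (n : ℕ)
    (u : Matrix.GeneralLinearGroup (Fin n) F)
    (hu : IsNilpotent ((u : Matrix (Fin n) (Fin n) F) - 1))
    (hup : u ^ p = 1) :
    ∃ φ : Matrix.SpecialLinearGroup (Fin 2) F →* Matrix.GeneralLinearGroup (Fin n) F,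
      u ∈ Set.range φ := by
  have : Fact p.Prime := ⟨hp⟩
  obtain ⟨m, hm, rfl⟩ := hq
  have : CharP F p := by
    obtain ⟨r, hr⟩ := CharP.exists F
    obtain ⟨k, hr', hk⟩ := FiniteField.card F r
    have hpr : p = r := by
      rw [hcard] at hk
      exact (Nat.prime_dvd_prime_iff_eq hp hr').mp
        (hp.dvd_of_dvd_pow (hk ▸ dvd_pow_self p hm.ne'))
    exact hpr ▸ hr
  let a : Module.End F (Fin n → F) := Matrix.toLinAlgEquiv' (u : Matrix (Fin n) (Fin n) F)
  have ha : a ^ p = 1 := by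
    rw [← map_pow, ← Units.val_pow_eq_pow_val, hup, Units.val_one, map_one]
  obtain ⟨ρ, hρ⟩ := extendsToSL2_of_pow_char_eq_zero p (a - 1) (sub_one_pow_char_eq_zero p a ha)
  refine ⟨(((Matrix.toLinAlgEquiv' (R := F) (n := Fin n)).symm :
    Module.End F (Fin n → F) →* Matrix (Fin n) (Fin n) F).comp ρ).toHomUnits, stdUnipotent F, ?_⟩
  ext1
  simp [hρ, a]
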